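/- Let X be a metric space, p ∈ X, R > 0, and let g be a bijective isometry of X with dist(p, g p) < R. If ‖g‖_R = 0 — equivalently, if g x = x for every x ∈ B(p, R) with g x ∈ B(p, R) — then g fixes the ball B(p, R) pointwise: g x = x for every x ∈ B(p, R). -/

import Mathlib

/-- Let `g` be a bijective isometry of a metric space `X` with
`dist p (g p) < R`.  If `g` fixes every point `x` of the open ball `B(p, R)` whose image
`g x` also lies in `B(p, R)` (i.e. the action pseudoseminorm `‖g‖_R` vanishes), then `g`
fixes the ball `B(p, R)` pointwise. -/
theorem fixes_ball_of_actionSeminorm_eq_zero {X : Type*} [MetricSpace X] (p : X) (R : ℝ)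
    (hR : 0 < R) (g : X ≃ᵢ X) (hgp : dist p (g p) < R)
    (h : ∀ x ∈ Metric.ball p R, g x ∈ Metric.ball p R → g x = x) :
    ∀ x ∈ Metric.ball p R, g x = x := by
  have hp : g p = p :=
    h p (Metric.mem_ball_self hR) (Metric.mem_ball.2 (by rwa [dist_comm]))
  intro x hx
  refine h x hx ?_
  have hd : dist (g x) p = dist x p := by
    simpa only [hp] using g.isometry.dist_eq x p
  rw [Metric.mem_ball] at hx ⊢
  rwa [hd]
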